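/- The sequence ex₂(n, C₁₄)/n converges to 1/3 as n → ∞; that is, the codegree Turán density of the 3-uniform tight cycle C₁₄ equals 1/3. -/

import Mathlib

open Finset

/-- A 3-uniform hypergraph given by its edge set: every edge has exactly 3 vertices. -/
def IsUniform3 {V : Type*} (H : Finset (Finset V)) : Prop :=
  ∀ e ∈ H, e.card = 3

/-- The codegree of a pair of vertices: the number of vertices `w` with `{u,v,w} ∈ H`. -/
noncomputable def codeg {V : Type*} [DecidableEq V] (H : Finset (Finset V)) (u v : V) : ℕ :=
  {w : V | ({u, v, w} : Finset V) ∈ H}.ncard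

/-- The minimum codegree `δ₂(H)`: the minimum of `codeg H u v` over pairs of distinct vertices. -/
noncomputable def minCodeg {V : Type*} [DecidableEq V] (H : Finset (Finset V)) : ℕ :=
  sInf {d : ℕ | ∃ u v : V, u ≠ v ∧ codeg H u v = d}

/-- `H` contains a homomorphic copy of the tight cycle `C_ℓ`: a cyclic sequence of vertices
(indexed by `ZMod ℓ`, not necessarily distinct) in which every three cyclically consecutive
vertices are pairwise distinct and form an edge of `H`. -/
def HasHomTightCycle {V : Type*} [DecidableEq V] (ℓ : ℕ) (H : Finset (Finset V)) : Prop :=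
  ∃ x : ZMod ℓ → V, ∀ i : ZMod ℓ,
    x (i - 1) ≠ x i ∧ x i ≠ x (i + 1) ∧ x (i - 1) ≠ x (i + 1) ∧
      ({x (i - 1), x i, x (i + 1)} : Finset V) ∈ H

/-- `H` contains a (genuine) copy of the tight cycle `C_ℓ`: `ℓ` distinct vertices, cyclically
ordered, such that every three cyclically consecutive vertices form an edge of `H`. -/
def HasTightCycle {V : Type*} [DecidableEq V] (ℓ : ℕ) (H : Finset (Finset V)) : Prop :=
  ∃ x : ZMod ℓ → V, Function.Injective x ∧
    ∀ i : ZMod ℓ, ({x (i - 1), x i, x (i + 1)} : Finset V) ∈ H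

/-- The arc `u → v` of the apex digraph `D`: some `K₄⁻` of `H` contains `u` and `v`
with apex `v`; i.e. there are two further vertices `a, b` (with `u,v,a,b` distinct)
such that the three edges through `v` on `{u,v,a,b}` all lie in `H`. -/
def ArcD {V : Type*} [DecidableEq V] (H : Finset (Finset V)) (u v : V) : Prop :=
  ∃ a b : V, ({u, v, a, b} : Finset V).card = 4 ∧
    ({v, u, a} : Finset V) ∈ H ∧ ({v, u, b} : Finset V) ∈ H ∧ ({v, a, b} : Finset V) ∈ H

/-- `{u,v}` is a base pair: some `K₄⁻` of `H` contains `u` and `v` with neither `u` nor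
`v` being the apex; i.e. there are further vertices `w, a` (with `u,v,w,a` distinct) with
apex `w`, so that the three edges through `w` on `{u,v,w,a}` all lie in `H`. -/
def BasePair {V : Type*} [DecidableEq V] (H : Finset (Finset V)) (u v : V) : Prop :=
  ∃ w a : V, ({u, v, w, a} : Finset V).card = 4 ∧
    ({w, u, v} : Finset V) ∈ H ∧ ({w, u, a} : Finset V) ∈ H ∧ ({w, v, a} : Finset V) ∈ H

/-- The degree of `v` in the base-pair graph `B`. -/
noncomputable def degB {V : Type*} [DecidableEq V] (H : Finset (Finset V)) (v : V) : ℕ :=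
  {u : V | BasePair H u v}.ncard

/-- The out-degree of `v` in the apex digraph `D`. -/
noncomputable def outDegD {V : Type*} [DecidableEq V] (H : Finset (Finset V)) (v : V) : ℕ :=
  {u : V | ArcD H v u}.ncard

/-- The in-degree of `v` in the apex digraph `D`. -/
noncomputable def inDegD {V : Type*} [DecidableEq V] (H : Finset (Finset V)) (v : V) : ℕ :=
  {u : V | ArcD H u v}.ncard

/-- The codegree Turán number `ex₂(n, C_ℓ)`: the maximum of `δ₂(H)` over all 3-uniform
hypergraphs `H` on `n` vertices containing no copy of the tight cycle `C_ℓ`. -/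
noncomputable def exCodeg (ℓ n : ℕ) : ℕ :=
  sSup {k : ℕ | ∃ H : Finset (Finset (Fin n)),
    IsUniform3 H ∧ ¬ HasTightCycle ℓ H ∧ minCodeg H = k}

section Game

variable {V : Type*}

/-- `Forces P c k S`: one can adjoin `k` vertices to `S` one at a time, each time having at least
`c * |V|` choices, so that every resulting set satisfies `P`. -/
def Forces (P : Set V → Prop) (c : ℝ) : ℕ → Set V → Prop
  | 0, S => P S
  | k + 1, S => c * Nat.card V ≤ {x | Forces P c k (insert x S)}.ncard

variable [Finite V] {P : Set V → Prop} {c : ℝ} {k : ℕ} {S : Set V}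

lemma Forces.draw {X : Set V} (hX : c * Nat.card V ≤ X.ncard)
    (h : ∀ x ∈ X, Forces P c k (insert x S)) : Forces P c (k + 1) S :=
  hX.trans (Nat.cast_le.2 (Set.ncard_le_ncard h))

lemma Forces.of_pred (hP : Monotone P) (hc : c ≤ 1) (h : P S) : Forces P c k S := by
  induction k generalizing S with
  | zero => exact h
  | succ k ih =>
    refine Forces.draw (X := Set.univ) ?_ fun x _ => ih (hP (Set.subset_insert x S) h)
    rw [Set.ncard_univ]
    exact mul_le_of_le_one_left (Nat.cast_nonneg _) hc

/-- Among three sets of average density at least `1/3 + c`, two meet in density at least `c`. -/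
lemma exists_dense_inter {A B C : Set V} (hA : (1 / 3 + c) * Nat.card V ≤ A.ncard)
    (hB : (1 / 3 + c) * Nat.card V ≤ B.ncard) (hC : (1 / 3 + c) * Nat.card V ≤ C.ncard) :
    c * Nat.card V ≤ (A ∩ B).ncard ∨ c * Nat.card V ≤ (A ∩ C).ncard ∨
      c * Nat.card V ≤ (B ∩ C).ncard := by
  by_contra! h
  have h1 := Set.ncard_union_add_ncard_inter A B
  have h2 := Set.ncard_union_add_ncard_inter (A ∪ B) C
  have h3 : ((A ∪ B) ∩ C).ncard ≤ (A ∩ C).ncard + (B ∩ C).ncard := by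
    rw [Set.union_inter_distrib_right]
    exact Set.ncard_union_le _ _
  have h4 : (A ∪ B ∪ C).ncard ≤ Nat.card V := Set.ncard_le_card _
  have h5 : A.ncard + B.ncard + C.ncard ≤
      Nat.card V + (A ∩ B).ncard + (A ∩ C).ncard + (B ∩ C).ncard := by omega
  have h6 : (A.ncard + B.ncard + C.ncard : ℝ) ≤
      Nat.card V + (A ∩ B).ncard + (A ∩ C).ncard + (B ∩ C).ncard := by exact_mod_cast h5
  linarith [h.1, h.2.1, h.2.2]

end Game

section Apex

variable {V : Type*} [DecidableEq V] {H : Finset (Finset V)} {S T : Set V} {a b c u v w x : V}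

/-- `S` supports a closed tight walk of length `14`. -/
def ClosedWalkIn (H : Finset (Finset V)) (S : Set V) : Prop :=
  ∃ x : ZMod 14 → V, (∀ i, x i ∈ S) ∧ ∀ i, ({x (i - 1), x i, x (i + 1)} : Finset V) ∈ H

lemma closedWalkIn_mono : Monotone (ClosedWalkIn H) :=
  fun _ _ hST ⟨x, hx, h⟩ => ⟨x, fun i => hST (hx i), h⟩

/-- Inside `S` there is a copy of `K₄⁻` with apex `a` containing the edge `abc`. -/
def Apex (H : Finset (Finset V)) (S : Set V) (a b c : V) : Prop :=
  a ∈ S ∧ b ∈ S ∧ c ∈ S ∧ ({a, b, c} : Finset V) ∈ H ∧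
    ∃ p ∈ S, ({a, b, p} : Finset V) ∈ H ∧ ({a, c, p} : Finset V) ∈ H

/-- Inside `S` there is a copy of `K₄⁻` with apex `u` containing `v`. -/
def Spoke (H : Finset (Finset V)) (S : Set V) (u v : V) : Prop := ∃ x, Apex H S u v x

/-- Inside `S` there is a copy of `K₄⁻` in which `u` and `v` are not the apex. -/
def Base (H : Finset (Finset V)) (S : Set V) (u v : V) : Prop := ∃ x, Apex H S x u v

lemma Apex.symm (h : Apex H S a b c) : Apex H S a c b := by
  obtain ⟨ha, hb, hc, e, p, hp, e1, e2⟩ := h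
  exact ⟨ha, hc, hb, by rwa [pair_comm c b], p, hp, e2, e1⟩

lemma Apex.mono (hST : S ⊆ T) (h : Apex H S a b c) : Apex H T a b c := by
  obtain ⟨ha, hb, hc, e, p, hp, e1, e2⟩ := h
  exact ⟨hST ha, hST hb, hST hc, e, p, hST hp, e1, e2⟩

lemma Spoke.mono (hST : S ⊆ T) : Spoke H S u v → Spoke H T u v :=
  fun ⟨x, h⟩ => ⟨x, h.mono hST⟩

lemma Base.mono (hST : S ⊆ T) : Base H S u v → Base H T u v :=
  fun ⟨x, h⟩ => ⟨x, h.mono hST⟩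

lemma Base.symm : Base H S u v → Base H S v u := fun ⟨x, h⟩ => ⟨x, h.symm⟩

lemma edge_swap_left (h : ({a, b, c} : Finset V) ∈ H) : ({b, a, c} : Finset V) ∈ H := by
  rwa [insert_comm]

lemma edge_swap_right (h : ({a, b, c} : Finset V) ∈ H) : ({a, c, b} : Finset V) ∈ H := by
  rwa [pair_comm]

lemma closedWalkIn_of_vec (y : Fin 14 → V) (hS : ∀ i, y i ∈ S)
    (hy : ∀ i, ({y (i - 1), y i, y (i + 1)} : Finset V) ∈ H) : ClosedWalkIn H S :=
  ⟨y, hS, hy⟩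

lemma Spoke.closedWalkIn_of_spoke (h : Spoke H S u v) (h' : Spoke H S v u) :
    ClosedWalkIn H S := by
  obtain ⟨x, hu, hv, hx, e, p, hp, e1, e2⟩ := h
  obtain ⟨y, -, -, hy, f, q, hq, f1, f2⟩ := h'
  have s1 := fun a b c => @edge_swap_left V _ H a b c
  have s2 := fun a b c => @edge_swap_right V _ H a b c
  refine closedWalkIn_of_vec ![v, u, x, v, u, x, v, u, x, p, u, v, y, q] ?_ ?_
  · simp [Fin.forall_fin_succ, *]
  · intro i
    fin_cases i <;> simp <;> grind

lemma Base.closedWalkIn_of_spoke (h : Base H S u v) (h' : Spoke H S u v) :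
    ClosedWalkIn H S := by
  obtain ⟨x, hx, hu, hv, e, p, hp, e1, e2⟩ := h
  obtain ⟨y, -, -, hy, f, q, hq, f1, f2⟩ := h'
  have s1 := fun a b c => @edge_swap_left V _ H a b c
  have s2 := fun a b c => @edge_swap_right V _ H a b c
  refine closedWalkIn_of_vec ![u, v, y, u, v, y, u, q, v, u, x, v, p, x] ?_ ?_
  · simp [Fin.forall_fin_succ, *]
  · intro i
    fin_cases i <;> simp <;> grind

end Apex

lemma IsUniform3.ne_left {V : Type*} [DecidableEq V] {H : Finset (Finset V)} {a b c : V}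
    (hH : IsUniform3 H) (h : ({a, b, c} : Finset V) ∈ H) : a ≠ b := by
  rintro rfl
  have h1 := hH _ h
  have h2 := Finset.card_le_two (a := a) (b := c)
  simp only [insert_eq_of_mem, mem_insert, true_or] at h1
  omega

lemma IsUniform3.ne_right {V : Type*} [DecidableEq V] {H : Finset (Finset V)} {a b c : V}
    (hH : IsUniform3 H) (h : ({a, b, c} : Finset V) ∈ H) : b ≠ c :=
  hH.ne_left (edge_swap_right (edge_swap_left h))

lemma dense_diff_singleton {V : Type*} [Finite V] {ε : ℝ} (hn : 3 ≤ Nat.card V) {X : Set V}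
    (hX : (1 / 3 + ε) * Nat.card V ≤ X.ncard) (a : V) :
    ε * Nat.card V ≤ (X \ {a}).ncard := by
  have h1 : X.ncard ≤ (X \ {a}).ncard + 1 := by
    simpa using Set.ncard_le_ncard_sdiff_add_ncard X {a}
  have h2 : (X.ncard : ℝ) ≤ (X \ {a}).ncard + 1 := by exact_mod_cast h1
  have h3 : (3 : ℝ) ≤ Nat.card V := by exact_mod_cast hn
  linarith

section Forcing

variable {V : Type*} [DecidableEq V] [Finite V] {H : Finset (Finset V)} {S : Set V}
  {a b c u v w x y z : V} {ε : ℝ} {k : ℕ}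

/-- Every codegree of `H` is at least `(1 / 3 + ε) * |V|`. -/
def CodegreeGE (H : Finset (Finset V)) (ε : ℝ) : Prop :=
  ∀ u v : V, u ≠ v → (1 / 3 + ε) * Nat.card V ≤ {w | ({u, v, w} : Finset V) ∈ H}.ncard

lemma forces_of_edge (hH : IsUniform3 H) (hd : CodegreeGE H ε) (ha : a ∈ S) (hb : b ∈ S)
    (hc : c ∈ S) (e : ({a, b, c} : Finset V) ∈ H)
    (h1 : ∀ T, S ⊆ T → Apex H T a b c → Forces (ClosedWalkIn H) ε k T)
    (h2 : ∀ T, S ⊆ T → Apex H T b a c → Forces (ClosedWalkIn H) ε k T)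
    (h3 : ∀ T, S ⊆ T → Apex H T c a b → Forces (ClosedWalkIn H) ε k T) :
    Forces (ClosedWalkIn H) ε (k + 1) S := by
  have hs : ∀ x, S ⊆ insert x S := fun x => Set.subset_insert x S
  have e' := edge_swap_right e
  rcases exists_dense_inter (hd a b (hH.ne_left e)) (hd a c (hH.ne_left e'))
    (hd b c (hH.ne_right e)) with h | h | h
  · exact .draw h fun p hp => h1 _ (hs p)
      ⟨hs p ha, hs p hb, hs p hc, e, p, Set.mem_insert p S, hp.1, hp.2⟩
  · exact .draw h fun p hp => h2 _ (hs p)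
      ⟨hs p hb, hs p ha, hs p hc, edge_swap_left e, p, Set.mem_insert p S,
        edge_swap_left hp.1, hp.2⟩
  · exact .draw h fun p hp => h3 _ (hs p)
      ⟨hs p hc, hs p ha, hs p hb, edge_swap_left e', p, Set.mem_insert p S,
        edge_swap_left hp.1, edge_swap_left hp.2⟩

lemma Spoke.forces_apex (hH : IsUniform3 H) (hd : CodegreeGE H ε) (hε : ε ≤ 1)
    (hs : Spoke H S u v) (hz : z ∈ S) (e : ({u, v, z} : Finset V) ∈ H)
    (h : ∀ T, S ⊆ T → Apex H T u v z → Forces (ClosedWalkIn H) ε k T) :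
    Forces (ClosedWalkIn H) ε (k + 1) S := by
  obtain ⟨-, hu, hv, -⟩ := id hs
  exact forces_of_edge hH hd hu hv hz e h
    (fun T hT hA => .of_pred closedWalkIn_mono hε
      ((hs.mono hT).closedWalkIn_of_spoke ⟨z, hA⟩))
    (fun T hT hA => .of_pred closedWalkIn_mono hε
      (Base.closedWalkIn_of_spoke ⟨z, hA⟩ (hs.mono hT)))

lemma Base.forces_apex (hH : IsUniform3 H) (hd : CodegreeGE H ε) (hε : ε ≤ 1)
    (hs : Base H S u v) (hz : z ∈ S) (e : ({u, v, z} : Finset V) ∈ H)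
    (h : ∀ T, S ⊆ T → Apex H T z u v → Forces (ClosedWalkIn H) ε k T) :
    Forces (ClosedWalkIn H) ε (k + 1) S := by
  obtain ⟨-, -, hu, hv, -⟩ := id hs
  exact forces_of_edge hH hd hu hv hz e
    (fun T hT hA => .of_pred closedWalkIn_mono hε
      ((hs.mono hT).closedWalkIn_of_spoke ⟨z, hA⟩))
    (fun T hT hA => .of_pred closedWalkIn_mono hε
      ((hs.symm.mono hT).closedWalkIn_of_spoke ⟨z, hA⟩)) h

/-- A vertex cannot be an apex, a spoke end and a base vertex at the same time: the three
neighbourhoods involved would have to be disjoint. -/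
lemma forces_of_spoke_spoke_base (hH : IsUniform3 H) (hd : CodegreeGE H ε) (hε : ε ≤ 1)
    (hb : Spoke H S y b) (ha : Spoke H S a y) (hw : Base H S y w) :
    Forces (ClosedWalkIn H) ε 3 S := by
  have hyb : y ≠ b := by
    obtain ⟨_, _, _, _, e, _⟩ := hb
    exact hH.ne_left e
  have hay : a ≠ y := by
    obtain ⟨_, _, _, _, e, _⟩ := ha
    exact hH.ne_left e
  have hyw : y ≠ w := by
    obtain ⟨_, _, _, _, e, _⟩ := hw
    exact hH.ne_right e
  have hs : ∀ x, S ⊆ insert x S := fun x => Set.subset_insert x S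
  rcases exists_dense_inter (hd y b hyb) (hd a y hay) (hd y w hyw) with h | h | h
  · refine .draw h fun z hz => (hb.mono (hs z)).forces_apex hH hd hε (Set.mem_insert z S) hz.1
      fun T hT hA => ((ha.mono (hs z)).mono hT).forces_apex hH hd hε
      (hT (Set.mem_insert z S)) hz.2 fun U hU hB => ?_
    exact Base.closedWalkIn_of_spoke ⟨a, hB⟩ ⟨b, (hA.mono hU).symm⟩
  · refine .draw h fun z hz => (hb.mono (hs z)).forces_apex hH hd hε (Set.mem_insert z S) hz.1
      fun T hT hA => ((hw.mono (hs z)).mono hT).forces_apex hH hd hε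
      (hT (Set.mem_insert z S)) hz.2 fun U hU hB => ?_
    exact Spoke.closedWalkIn_of_spoke ⟨w, hB⟩ ⟨b, (hA.mono hU).symm⟩
  · refine .draw h fun z hz => (ha.mono (hs z)).forces_apex hH hd hε (Set.mem_insert z S) hz.1
      fun T hT hA => ((hw.mono (hs z)).mono hT).forces_apex hH hd hε
      (hT (Set.mem_insert z S)) hz.2 fun U hU hB => ?_
    exact Base.closedWalkIn_of_spoke (Base.symm ⟨a, hA.mono hU⟩) ⟨w, hB⟩

lemma Apex.forces (hH : IsUniform3 H) (hd : CodegreeGE H ε) (hε : ε ≤ 1)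
    (hn : 3 ≤ Nat.card V) (h : Apex H S a b c) : Forces (ClosedWalkIn H) ε 7 S := by
  have hbc : b ≠ c := hH.ne_right h.2.2.2.1
  have hs : ∀ (S : Set V) x, S ⊆ insert x S := fun S x => Set.subset_insert x S
  refine .draw (dense_diff_singleton hn (hd b c hbc) a) fun y hy => ?_
  have hya : a ≠ y := fun e => hy.2 e.symm
  refine Base.forces_apex hH hd hε ⟨a, h.mono (hs S y)⟩ (Set.mem_insert y S) hy.1
    fun T hT hA => ?_
  have hT' := (hs S y).trans hT
  refine .draw (X := {w | ({a, y, w} : Finset V) ∈ H}) (le_trans ?_ (hd a y hya))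
    fun w hw => ?_
  · gcongr
    linarith
  have hTw := hs T w
  refine forces_of_edge hH hd (hTw (hT' h.1)) (hTw hA.1) (Set.mem_insert w T) hw ?_ ?_ ?_
  · intro U hU hB
    exact forces_of_spoke_spoke_base hH hd hε ⟨c, (hA.mono hTw).mono hU⟩ ⟨w, hB⟩ ⟨a, hB⟩
  · intro U hU hB
    exact forces_of_spoke_spoke_base hH hd hε ⟨c, h.mono (hT'.trans (hTw.trans hU))⟩
      ⟨w, hB⟩ ⟨y, hB⟩
  · intro U hU hB
    exact forces_of_spoke_spoke_base hH hd hε ⟨c, (hA.mono hTw).mono hU⟩ ⟨a, hB.symm⟩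
      (Base.symm ⟨w, hB⟩)

lemma forces_closedWalkIn (hH : IsUniform3 H) (hd : CodegreeGE H ε) (hε : ε ≤ 1 / 2)
    (hn : 3 ≤ Nat.card V) : Forces (ClosedWalkIn H) ε 11 ∅ := by
  have hn' : (3 : ℝ) ≤ Nat.card V := by exact_mod_cast hn
  have huniv : (1 / 3 + ε) * Nat.card V ≤ (Set.univ : Set V).ncard := by
    rw [Set.ncard_univ]
    exact mul_le_of_le_one_left (by positivity) (by linarith)
  have hweak : ∀ {X : Set V}, (1 / 3 + ε) * Nat.card V ≤ X.ncard → ε * Nat.card V ≤ X.ncard :=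
    fun h => le_trans (by gcongr; linarith) h
  have hε1 : ε ≤ 1 := by linarith
  refine .draw (hweak huniv) fun b _ => .draw (dense_diff_singleton hn huniv b) fun c hc =>
    .draw (hweak (hd b c fun e => hc.2 e.symm)) fun a ha => ?_
  exact forces_of_edge hH hd (by simp) (by simp) (by simp) ha
    (fun T _ hA => hA.forces hH hd hε1 hn) (fun T _ hA => hA.forces hH hd hε1 hn)
    (fun T _ hA => hA.forces hH hd hε1 hn)

end Forcing

section Blowup

open scoped Classical

lemma card_filter_cons {V : Type*} [Fintype V] {k : ℕ} (Q : (Fin (k + 1) → V) → Prop)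
    [DecidablePred Q] :
    #{t | Q t} = ∑ x, #{t : Fin k → V | Q (Fin.cons x t)} := by
  simp only [card_filter]
  rw [← Fintype.sum_prod_type' fun x (t : Fin k → V) => if Q (Fin.cons x t) then 1 else 0]
  exact (Equiv.sum_comp (Fin.consEquiv fun _ => V) fun t => if Q t then 1 else 0).symm

lemma Forces.card_tuples_ge {V : Type*} [Fintype V] {P : Set V → Prop} {c : ℝ} (hc : 0 ≤ c)
    {k : ℕ} {S : Set V} (h : Forces P c k S) :
    c ^ k * (Fintype.card V : ℝ) ^ k ≤ #{t : Fin k → V | P (S ∪ Set.range t)} := by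
  induction k generalizing S with
  | zero =>
    have h' : P S := h
    simp [h']
  | succ k ih =>
    rw [card_filter_cons]
    push_cast
    have h' : c * Nat.card V ≤ {x | Forces P c k (insert x S)}.ncard := h
    rw [Nat.card_eq_fintype_card, Set.ncard_eq_toFinset_card'] at h'
    calc c ^ (k + 1) * (Fintype.card V : ℝ) ^ (k + 1)
        = (c * Fintype.card V) * (c ^ k * (Fintype.card V : ℝ) ^ k) := by ring
      _ ≤ #{x | Forces P c k (insert x S)}.toFinset * (c ^ k * (Fintype.card V : ℝ) ^ k) := by
        gcongr
      _ = ∑ x ∈ {x | Forces P c k (insert x S)}.toFinset, c ^ k * (Fintype.card V : ℝ) ^ k := by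
        rw [sum_const, nsmul_eq_mul]
      _ ≤ ∑ x ∈ {x | Forces P c k (insert x S)}.toFinset,
          (#{t : Fin k → V | P (S ∪ Set.range (Fin.cons x t : Fin (k + 1) → V))} : ℝ) := by
        refine sum_le_sum fun x hx => ?_
        simp only [Fin.range_cons, Set.union_insert, ← Set.insert_union]
        exact ih (by simpa using hx)
      _ ≤ _ := sum_le_univ_sum_of_nonneg fun _ => by positivity

lemma Forces.card_range_ge {V : Type*} [Fintype V] {P : Set V → Prop} {c : ℝ} (hc : 0 ≤ c)
    {k : ℕ} (h : Forces P c k ∅) :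
    c ^ k * (Fintype.card V : ℝ) ^ k ≤ #{t : Fin k → V | P (Set.range t)} :=
  (h.card_tuples_ge hc).trans (Nat.cast_le.2 (card_le_card fun t ht =>
    mem_filter.2 ⟨mem_univ t, by simpa using ht⟩))

/-- Density of blow-ups: if a `k`-ary relation has density at least `c` on average over `Y`, then
its `m`-fold blow-up has density at least `c ^ m ^ k`. -/
lemma blowup_density.{u} {V Y : Type u} [Fintype V] [Fintype Y] {c : ℝ} (hc : 0 ≤ c) (k m : ℕ)
    (A : (Fin k → V) → Y → Prop)
    (hA : c * (Fintype.card V : ℝ) ^ k * Fintype.card Y ≤ ∑ y, (#{t | A t y} : ℝ)) :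
    c ^ (m + 1) ^ k * ((Fintype.card V : ℝ) ^ (m + 1)) ^ k * Fintype.card Y ≤
      ∑ y, (#{g : Fin k → Fin (m + 1) → V | ∀ s : Fin k → Fin (m + 1),
        A (fun i => g i (s i)) y} : ℝ) := by
  induction k generalizing Y with
  | zero =>
    simp only [pow_zero, pow_one, mul_one] at hA ⊢
    refine hA.trans (le_of_eq (sum_congr rfl fun y _ => ?_))
    simp only [card_filter, Fintype.sum_unique]
    congr 2
    exact propext ⟨fun h s => by convert h, fun h => by convert h default⟩
  | succ k ih =>
    set n : ℝ := (Fintype.card V : ℝ) with hn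
    set d : Y × (Fin k → Fin (m + 1) → V) → ℝ := fun p =>
      #{x | ∀ s : Fin k → Fin (m + 1), A (Fin.cons x fun i => p.2 i (s i)) p.1} with hd
    set I : ℝ := (n ^ (m + 1)) ^ k * Fintype.card Y with hI
    have hIcard : (Fintype.card (Y × (Fin k → Fin (m + 1) → V)) : ℝ) = I := by
      simp [hI, hn, mul_comm]
    have hsum : c ^ (m + 1) ^ k * n * I ≤ ∑ p, d p := by
      have h := ih (Y := V × Y) (fun t p => A (Fin.cons p.1 t) p.2) (by
        rw [Fintype.sum_prod_type_right]
        simp only [card_filter_cons] at hA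
        push_cast at hA
        refine le_trans (le_of_eq ?_) hA
        rw [Fintype.card_prod]
        push_cast
        ring)
      rw [Fintype.card_prod] at h
      push_cast at h
      refine le_trans (le_of_eq (by simp only [hI, hn]; ring)) (h.trans (le_of_eq ?_))
      rw [Fintype.sum_prod_type_right, Fintype.sum_prod_type]
      refine sum_congr rfl fun y _ => ?_
      simp only [hd, card_filter, Nat.cast_sum]
      exact sum_comm
    have hpow : (∑ p, d p) ^ (m + 1) ≤ I ^ m * ∑ p, d p ^ (m + 1) := by
      rw [← hIcard]
      exact pow_sum_le_card_mul_sum_pow (fun _ _ => Nat.cast_nonneg _) m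
    have hcount : ∑ p, d p ^ (m + 1) = ∑ y, (#{g : Fin (k + 1) → Fin (m + 1) → V |
        ∀ s : Fin (k + 1) → Fin (m + 1), A (fun i => g i (s i)) y} : ℝ) := by
      rw [Fintype.sum_prod_type]
      refine sum_congr rfl fun y _ => ?_
      rw [card_filter_cons]
      push_cast
      simp only [card_filter, Nat.cast_sum]
      rw [sum_comm]
      refine sum_congr rfl fun g _ => ?_
      have h := Fintype.card_piFinset_const
        ({x | ∀ s : Fin k → Fin (m + 1), A (Fin.cons x fun i => g i (s i)) y} : Finset V) (m + 1)
      simp only [hd]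
      rw [← Nat.cast_pow, ← h, ← Nat.cast_sum, ← card_filter]
      congr 2
      ext f
      simp only [Fintype.mem_piFinset, mem_filter, mem_univ, true_and]
      rw [Fin.forall_fin_succ_pi]
      refine forall_congr' fun j => forall_congr' fun s => ?_
      have : (fun i => (Fin.cons f g : Fin (k + 1) → Fin (m + 1) → V) i
          ((Fin.cons j s : Fin (k + 1) → Fin (m + 1)) i)) =
          (Fin.cons (f j) fun i => g i (s i) : Fin (k + 1) → V) := by
        ext i
        refine Fin.cases ?_ (fun i => ?_) i <;> simp
      rw [this]
    rw [← hcount]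
    have hI0 : 0 ≤ I := by positivity
    rcases hI0.eq_or_lt with h0 | h0
    · refine le_trans (le_of_eq ?_) (sum_nonneg fun p _ => pow_nonneg (Nat.cast_nonneg _) _)
      calc c ^ (m + 1) ^ (k + 1) * (n ^ (m + 1)) ^ (k + 1) * Fintype.card Y
          = c ^ (m + 1) ^ (k + 1) * n ^ (m + 1) * I := by rw [hI]; ring
        _ = 0 := by rw [← h0, mul_zero]
    · refine le_of_mul_le_mul_left ?_ (pow_pos h0 m)
      refine le_trans (le_of_eq ?_) ((pow_le_pow_left₀ (by positivity) hsum (m + 1)).trans hpow)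
      have hc : c ^ (m + 1) ^ (k + 1) = (c ^ (m + 1) ^ k) ^ (m + 1) := by
        rw [← pow_mul, ← pow_succ]
      have hn : (n ^ (m + 1)) ^ (k + 1) * Fintype.card Y = n ^ (m + 1) * I := by
        rw [hI]
        ring
      rw [mul_assoc, hn, hc]
      ring

lemma card_collision_mul_le {ι V : Type*} [Fintype ι] [DecidableEq ι] [Fintype V]
    {a b : ι} (hab : a ≠ b) :
    Fintype.card V * #{g : ι → V | g a = g b} ≤ Fintype.card V ^ Fintype.card ι := by
  rw [← Fintype.card_fun, ← card_univ, ← card_product]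
  refine card_le_card_of_injOn (fun p => Function.update p.2 a p.1) (by simp) ?_
  rintro ⟨x, g⟩ hg ⟨y, h⟩ hh e
  simp only [coe_product, Set.mem_prod, mem_coe, mem_filter, mem_univ, true_and] at hg hh
  have e' : ∀ i, Function.update g a x i = Function.update h a y i := congrFun e
  have key : ∀ i, i ≠ a → g i = h i := fun i hi => by simpa [hi] using e' i
  refine Prod.ext (by simpa using e' a) (funext fun i => ?_)
  by_cases hi : i = a
  · subst hi
    exact hg.trans ((key b hab.symm).trans hh.symm)
  · exact key i hi

lemma exists_injective_of_dense {ι V : Type*} [Fintype ι] [DecidableEq ι] [Fintype V] {c : ℝ}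
    (hV : (Fintype.card ι : ℝ) ^ 2 < c * Fintype.card V) (B : (ι → V) → Prop)
    [DecidablePred B] (hB : c * (Fintype.card V : ℝ) ^ Fintype.card ι ≤ #{g | B g}) :
    ∃ g, B g ∧ Function.Injective g := by
  by_contra! h
  have hsub : ({g | B g} : Finset (ι → V)) ⊆
      (univ.filter fun p : ι × ι => p.1 ≠ p.2).biUnion fun p => {g | g p.1 = g p.2} := by
    intro g hg
    have hg' := h g (by simpa using hg)
    rw [Function.Injective] at hg'
    push Not at hg'
    obtain ⟨a, b, e, hab⟩ := hg'
    simp only [mem_biUnion, mem_filter, mem_univ, true_and]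
    exact ⟨(a, b), hab, e⟩
  have hle : Fintype.card V * #{g | B g} ≤
      Fintype.card ι ^ 2 * Fintype.card V ^ Fintype.card ι := by
    calc Fintype.card V * #{g | B g}
        ≤ Fintype.card V * ∑ p : ι × ι with p.1 ≠ p.2, #{g : ι → V | g p.1 = g p.2} :=
          Nat.mul_le_mul_left _ ((card_le_card hsub).trans card_biUnion_le)
      _ = ∑ p : ι × ι with p.1 ≠ p.2, Fintype.card V * #{g : ι → V | g p.1 = g p.2} :=
          mul_sum _ _ _
      _ ≤ ∑ p : ι × ι with p.1 ≠ p.2, Fintype.card V ^ Fintype.card ι :=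
          sum_le_sum fun p hp => card_collision_mul_le (mem_filter.1 hp).2
      _ = #{p : ι × ι | p.1 ≠ p.2} * Fintype.card V ^ Fintype.card ι := by
          rw [sum_const, smul_eq_mul]
      _ ≤ _ := by
          gcongr
          refine (card_filter_le _ _).trans ?_
          rw [card_univ, Fintype.card_prod, sq]
  have hV0 : (0 : ℝ) < Fintype.card V := by
    rcases (Nat.cast_nonneg (α := ℝ) (Fintype.card V)).eq_or_lt with h0 | h0
    · rw [← h0, mul_zero] at hV
      exact absurd hV (not_lt.2 (sq_nonneg _))
    · exact h0
  have hle' : (Fintype.card V : ℝ) * #{g | B g} ≤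
      (Fintype.card ι : ℝ) ^ 2 * (Fintype.card V : ℝ) ^ Fintype.card ι := by exact_mod_cast hle
  have h1 := mul_le_mul_of_nonneg_left hB hV0.le
  have h2 := mul_lt_mul_of_pos_right hV (pow_pos hV0 (Fintype.card ι))
  linarith

/-- If `H` has a positive density of `k`-tuples supporting a closed tight walk of length `14`,
and sufficiently many vertices, then it contains a tight cycle of length `14`. -/
lemma hasTightCycle_of_dense {c : ℝ} (hc : 0 < c) (k : ℕ) :
    ∃ n₀ : ℕ, ∀ (V : Type) [Fintype V] [DecidableEq V] (H : Finset (Finset V)),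
      IsUniform3 H → n₀ ≤ Fintype.card V →
      c * (Fintype.card V : ℝ) ^ k ≤ #{t : Fin k → V | ClosedWalkIn H (Set.range t)} →
      HasTightCycle 14 H := by
  set M : ℝ := Fintype.card (ZMod 14 → Fin k) + 1 with hM
  have hM0 : 0 < M := by positivity
  set c' : ℝ := (c / M) ^ (13 + 1) ^ k with hc'
  have hc'0 : 0 < c' := by positivity
  obtain ⟨n₀, hn₀⟩ := exists_nat_gt ((Fintype.card (Fin k × Fin (13 + 1)) : ℝ) ^ 2 / c')
  refine ⟨n₀, fun V _ _ H hH hn hA => ?_⟩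
  set n : ℝ := (Fintype.card V : ℝ) with hnV
  have hn' : (Fintype.card (Fin k × Fin (13 + 1)) : ℝ) ^ 2 < c' * n := by
    rw [mul_comm, ← div_lt_iff₀ hc'0]
    exact hn₀.trans_le (Nat.cast_le.2 hn)
  have hn0 : 0 < n := by
    by_contra! h
    nlinarith [sq_nonneg (Fintype.card (Fin k × Fin (13 + 1)) : ℝ)]
  obtain ⟨w, hw⟩ : ∃ w : ZMod 14 → Fin k, c / M * n ^ k ≤
      #{t : Fin k → V | ∀ i, ({t (w (i - 1)), t (w i), t (w (i + 1))} : Finset V) ∈ H} := by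
    by_contra! h
    have hsub : ({t : Fin k → V | ClosedWalkIn H (Set.range t)} : Finset (Fin k → V)) ⊆
        univ.biUnion fun w : ZMod 14 → Fin k =>
          {t | ∀ i, ({t (w (i - 1)), t (w i), t (w (i + 1))} : Finset V) ∈ H} := by
      intro t ht
      obtain ⟨x, hx, hxH⟩ := (mem_filter.1 ht).2
      choose w hw using hx
      simp only [mem_biUnion, mem_filter, mem_univ, true_and]
      exact ⟨w, fun i => by simpa only [hw] using hxH i⟩
    have h1 : (#{t : Fin k → V | ClosedWalkIn H (Set.range t)} : ℝ) ≤
        ∑ w : ZMod 14 → Fin k, (#{t : Fin k → V |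
          ∀ i, ({t (w (i - 1)), t (w i), t (w (i + 1))} : Finset V) ∈ H} : ℝ) := by
      exact_mod_cast (card_le_card hsub).trans card_biUnion_le
    have h2 := h1.trans (sum_le_sum fun w _ => (h w).le)
    rw [sum_const, nsmul_eq_mul, card_univ] at h2
    have h3 : 0 < c / M * n ^ k := by positivity
    have h4 : M * (c / M * n ^ k) = c * n ^ k := by field_simp
    rw [hM] at h4
    linarith
  have hblow := blowup_density (c := c / M) (Y := Unit) (by positivity) k 13
    (fun t _ => ∀ i, ({t (w (i - 1)), t (w i), t (w (i + 1))} : Finset V) ∈ H)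
    (by
      simp only [univ_unique, sum_singleton, Fintype.card_unit, Nat.cast_one, mul_one]
      convert hw)
  obtain ⟨g, hg, hinj⟩ := exists_injective_of_dense hn'
    (fun g : Fin k × Fin (13 + 1) → V => ∀ s : Fin k → Fin (13 + 1), ∀ i,
      ({g (w (i - 1), s (w (i - 1))), g (w i, s (w i)), g (w (i + 1), s (w (i + 1)))} :
        Finset V) ∈ H) (by
      refine le_trans (le_of_eq ?_) (hblow.trans (le_of_eq ?_))
      · simp [hc', ← pow_mul, mul_comm]
      · simp only [univ_unique, sum_singleton, card_filter]
        rw [← Equiv.sum_comp (Equiv.curry (Fin k) (Fin (13 + 1)) V)]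
        rfl)
  refine ⟨fun i => g (w i, i), fun i j h => congrArg Prod.snd (hinj h), fun i => ?_⟩
  have e := hg 0 i
  have h1 : w (i - 1) ≠ w i := fun h => hH.ne_left e (by rw [h])
  have h2 : w i ≠ w (i + 1) := fun h => hH.ne_right e (by rw [h])
  have h3 : w (i - 1) ≠ w (i + 1) := fun h => hH.ne_left (edge_swap_right e) (by rw [h])
  have e' := hg (fun a => (if a = w (i - 1) then i - 1 else if a = w i then i else i + 1 : ZMod 14)) i
  simpa [h1.symm, h2.symm, h3.symm] using e'

end Blowup

section LowerBound

/-- The triples of vertices whose sum is congruent to `1` modulo `3`. -/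
def sumModThree (n : ℕ) : Finset (Finset (Fin n)) :=
  {e | e.card = 3 ∧ (∑ x ∈ e, (x : ℕ)) % 3 = 1}

lemma mem_sumModThree {n : ℕ} {e : Finset (Fin n)} :
    e ∈ sumModThree n ↔ e.card = 3 ∧ (∑ x ∈ e, (x : ℕ)) % 3 = 1 := by
  simp [sumModThree]

lemma isUniform3_sumModThree (n : ℕ) : IsUniform3 (sumModThree n) :=
  fun _ he => (mem_sumModThree.1 he).1

lemma not_hasTightCycle_sumModThree (n : ℕ) : ¬ HasTightCycle 14 (sumModThree n) := by
  rintro ⟨x, -, h⟩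
  set g : ZMod 14 → ZMod 3 := fun i => ((x i : ℕ) : ZMod 3)
  have hsum : ∀ i, g (i - 1) + g i + g (i + 1) = 1 := by
    intro i
    have hu := isUniform3_sumModThree n
    have h1 := hu.ne_left (h i)
    have h2 := hu.ne_right (h i)
    have h3 := hu.ne_left (edge_swap_right (h i))
    have hs := (mem_sumModThree.1 (h i)).2
    rw [sum_insert (by simp [h1, h3]), sum_pair h2] at hs
    have hs' : ((x (i - 1) + (x i + x (i + 1)) : ℕ) : ZMod 3) = (1 : ℕ) :=
      (ZMod.natCast_eq_natCast_iff' _ _ 3).2 hs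
    push_cast at hs'
    rw [← hs', add_assoc]
  clear_value g
  have hstep : ∀ i, g (i + 3) = g i := by
    intro i
    have h1 := hsum (i + 1)
    have h2 := hsum (i + 2)
    rw [show i + 1 - 1 = i by ring, show i + 1 + 1 = i + 2 by ring] at h1
    rw [show i + 2 - 1 = i + 1 by ring, show i + 2 + 1 = i + 3 by ring] at h2
    linear_combination h2 - h1
  have hconst : ∀ i, g (i + 1) = g i := by
    intro i
    rw [show i + 1 = i + 3 + 3 + 3 + 3 + 3 by
      have : (14 : ZMod 14) = 0 := rfl
      linear_combination -this]
    simp only [hstep]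
  have h0 := hsum 0
  rw [← hconst (0 - 1), sub_add_cancel, hconst] at h0
  generalize g 0 = a at h0
  clear * - h0
  revert a
  decide

lemma codeg_sumModThree_ge {n : ℕ} {u v : Fin n} (huv : u ≠ v) :
    n / 3 ≤ codeg (sumModThree n) u v + 2 := by
  set r := (1 + 2 * (u : ℕ) + 2 * v) % 3 with hr
  have hsub : (Set.range fun j : Fin (n / 3) => (⟨3 * j + r, by omega⟩ : Fin n)) ⊆
      {w | ({u, v, w} : Finset (Fin n)) ∈ sumModThree n} ∪ {u, v} := by
    rintro w ⟨j, hw⟩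
    have hw' : (w : ℕ) = 3 * j + r := by rw [← hw]
    by_cases h1 : u = w
    · simp [h1]
    by_cases h2 : v = w
    · simp [h2]
    left
    refine mem_sumModThree.2 ⟨card_eq_three.2 ⟨u, v, w, huv, h1, h2, rfl⟩, ?_⟩
    rw [sum_insert (by simp [huv, h1]), sum_pair h2]
    omega
  have hinj : Function.Injective fun j : Fin (n / 3) => (⟨3 * j + r, by omega⟩ : Fin n) := by
    intro i j h
    simp only [Fin.mk.injEq] at h
    omega
  calc n / 3 = (Set.range fun j : Fin (n / 3) => (⟨3 * j + r, by omega⟩ : Fin n)).ncard := by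
        rw [Set.ncard_range_of_injective hinj, Nat.card_eq_fintype_card, Fintype.card_fin]
    _ ≤ _ := Set.ncard_le_ncard hsub
    _ ≤ _ := Set.ncard_union_le _ _
    _ ≤ _ := by
      rw [Set.ncard_pair huv]
      rfl

lemma codeg_le {n : ℕ} (H : Finset (Finset (Fin n))) (u v : Fin n) : codeg H u v ≤ n :=
  (Set.ncard_le_card _).trans_eq (Nat.card_fin n)

lemma exists_codeg_eq_minCodeg {n : ℕ} (hn : 2 ≤ n) (H : Finset (Finset (Fin n))) :
    ∃ u v : Fin n, u ≠ v ∧ codeg H u v = minCodeg H :=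
  Nat.sInf_mem (s := {d : ℕ | ∃ u v : Fin n, u ≠ v ∧ codeg H u v = d})
    ⟨_, ⟨0, by omega⟩, ⟨1, by omega⟩, by simp, rfl⟩

lemma le_exCodeg {n : ℕ} (hn : 2 ≤ n) : n / 3 ≤ exCodeg 14 n + 2 := by
  obtain ⟨u, v, huv, h⟩ := exists_codeg_eq_minCodeg hn (sumModThree n)
  have hle : minCodeg (sumModThree n) ≤ exCodeg 14 n := by
    refine le_csSup ⟨n, ?_⟩
      ⟨_, isUniform3_sumModThree n, not_hasTightCycle_sumModThree n, rfl⟩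
    rintro _ ⟨H, -, -, rfl⟩
    obtain ⟨u, v, -, h⟩ := exists_codeg_eq_minCodeg hn H
    exact h ▸ codeg_le H u v
  have := codeg_sumModThree_ge huv
  omega

end LowerBound

lemma exists_exCodeg_le {ε : ℝ} (hε : 0 < ε) (hε' : ε ≤ 1 / 2) :
    ∃ n₀ : ℕ, ∀ n ≥ n₀, (exCodeg 14 n : ℝ) ≤ (1 / 3 + ε) * n := by
  obtain ⟨n₀, h₀⟩ := hasTightCycle_of_dense (pow_pos hε 11) 11
  refine ⟨max n₀ 3, fun n hn => ?_⟩
  have hn₀ : n₀ ≤ n := (le_max_left _ _).trans hn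
  have hn3 : 3 ≤ n := (le_max_right _ _).trans hn
  have hmem : exCodeg 14 n ∈ {k : ℕ | ∃ H : Finset (Finset (Fin n)),
      IsUniform3 H ∧ ¬ HasTightCycle 14 H ∧ minCodeg H = k} := by
    refine Nat.sSup_mem
      ⟨_, _, isUniform3_sumModThree n, not_hasTightCycle_sumModThree n, rfl⟩ ⟨n, ?_⟩
    rintro _ ⟨H, -, -, rfl⟩
    obtain ⟨u, v, -, h⟩ := exists_codeg_eq_minCodeg (by omega) H
    exact h ▸ codeg_le H u v
  obtain ⟨H, hH, hC, hmin⟩ := hmem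
  by_contra! hlt
  have hd : CodegreeGE H ε := by
    intro u v huv
    have h1 : minCodeg H ≤ codeg H u v := Nat.sInf_le ⟨u, v, huv, rfl⟩
    rw [hmin] at h1
    rw [Nat.card_eq_fintype_card, Fintype.card_fin]
    exact hlt.le.trans (Nat.cast_le.2 h1)
  have hF := forces_closedWalkIn hH hd hε' (by simpa using hn3)
  refine hC (h₀ _ H hH (by simpa using hn₀) ?_)
  simpa using hF.card_range_ge hε.le

/-- The codegree Turán density of the tight cycle `C₁₄` equals `1/3`. -/
theorem codegree_turan_density_C14 :
    Filter.Tendsto (fun n : ℕ => (exCodeg 14 n : ℝ) / n) Filter.atTop (nhds (1 / 3)) := by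
  refine tendsto_order.2 ⟨fun a ha => ?_, fun a ha => ?_⟩
  · obtain ⟨n₀, hn₀⟩ := exists_nat_gt (3 / (1 / 3 - a))
    filter_upwards [Filter.eventually_ge_atTop (max n₀ 2)] with n hn
    have hn2 : 2 ≤ n := (le_max_right _ _).trans hn
    have h1 : n ≤ 3 * exCodeg 14 n + 8 := by
      have := le_exCodeg hn2
      omega
    have h2 : (n : ℝ) ≤ 3 * exCodeg 14 n + 8 := by exact_mod_cast h1
    have h3 : 3 / (1 / 3 - a) < n :=
      hn₀.trans_le (Nat.cast_le.2 ((le_max_left _ _).trans hn))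
    rw [div_lt_iff₀ (by linarith)] at h3
    rw [lt_div_iff₀ (by positivity)]
    linarith
  · obtain ⟨n₀, hn₀⟩ := exists_exCodeg_le (ε := min ((a - 1 / 3) / 2) (1 / 2))
      (lt_min (by linarith) (by norm_num)) (min_le_right _ _)
    filter_upwards [Filter.eventually_ge_atTop (max n₀ 1)] with n hn
    have hn1 : 1 ≤ n := (le_max_right _ _).trans hn
    have h0 : (0 : ℝ) < n := by exact_mod_cast hn1
    have h1 := hn₀ n ((le_max_left _ _).trans hn)
    rw [div_lt_iff₀ h0]
    refine h1.trans_lt (mul_lt_mul_of_pos_right ?_ h0)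
    linarith [min_le_left ((a - 1 / 3) / 2) (1 / 2)]
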